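/- Every 3-quasi-Sasakian manifold M^{4n+3} of maximal rank 4n+3 is necessarily 3-α-Sasakian (with α = c/2, where [ξ_α, ξ_β] = c ξ_γ). -/

import Mathlib

/-!
An abstract (Lie–Rinehart style) algebraic model of the differential geometry of
almost contact metric 3-structures: `F` plays the role of the algebra of smooth
functions on a manifold `M` of dimension `4n+3`, and `V` plays the role of the
`F`-module of smooth vector fields, acting on `F` by derivations and carrying a
Lie bracket, a Riemannian metric `g`, and three almost contact metric structures
`(φ_α, ξ_α, η_α, g)`.
-/

noncomputable section

namespace QS3

/-- Cyclic (= even) permutations of `{0,1,2}`, modelling even permutations of `{1,2,3}`. -/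
def Cyclic (a b c : Fin 3) : Prop :=
  (a, b, c) = (0, 1, 2) ∨ (a, b, c) = (1, 2, 0) ∨ (a, b, c) = (2, 0, 1)

/-- The algebraic model of the smooth structure of a manifold: an `ℝ`-algebra `F`
of smooth functions and an `F`-module `V` of vector fields acting on `F` by
derivations and carrying the Lie bracket of vector fields. -/
class SmoothSetting (F : Type) (V : Type) [CommRing F] [Algebra ℝ F]
    [AddCommGroup V] [Module F V] where
  act : V → F → F
  bracket : V → V → V
  act_add : ∀ (X : V) (f₁ f₂ : F), act X (f₁ + f₂) = act X f₁ + act X f₂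
  act_mul : ∀ (X : V) (f₁ f₂ : F), act X (f₁ * f₂) = act X f₁ * f₂ + f₁ * act X f₂
  act_const : ∀ (X : V) (r : ℝ), act X (algebraMap ℝ F r) = 0
  act_addLeft : ∀ (X Y : V) (f : F), act (X + Y) f = act X f + act Y f
  act_smulLeft : ∀ (f : F) (X : V) (h : F), act (f • X) h = f * act X h
  bracket_antisymm : ∀ X Y : V, bracket X Y = -bracket Y X
  bracket_addLeft : ∀ X Y Z : V, bracket (X + Y) Z = bracket X Z + bracket Y Z
  bracket_act : ∀ (X Y : V) (f : F),
    act (bracket X Y) f = act X (act Y f) - act Y (act X f)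
  bracket_smulRight : ∀ (X : V) (f : F) (Y : V),
    bracket X (f • Y) = f • bracket X Y + act X f • Y
  jacobi : ∀ X Y Z : V,
    bracket X (bracket Y Z) + bracket Y (bracket Z X) + bracket Z (bracket X Y) = 0

section d

variable (F V : Type) [CommRing F] [Algebra ℝ F] [AddCommGroup V] [Module F V]
  [SmoothSetting F V]

/-- The action of a vector field on a function (directional derivative). -/
def der (X : V) (f : F) : F := SmoothSetting.act X f

/-- The Lie bracket of vector fields. -/
def lie (X Y : V) : V := SmoothSetting.bracket F X Y

/-- Exterior differential of a 1-form (with the `1/2` normalization convention,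
so that `2 dθ(X,Y) = X θ(Y) - Y θ(X) - θ([X,Y])`). -/
def dOne (θ : V → F) (X Y : V) : F :=
  (2 : ℝ)⁻¹ • (der F V X (θ Y) - der F V Y (θ X) - θ (lie F V X Y))

/-- Exterior differential of a 2-form (with the `1/3` normalization convention). -/
def dTwo (ω : V → V → F) (X Y Z : V) : F :=
  (3 : ℝ)⁻¹ • (der F V X (ω Y Z) + der F V Y (ω Z X) + der F V Z (ω X Y)
    - ω (lie F V X Y) Z - ω (lie F V Y Z) X - ω (lie F V Z X) Y)

end d

/-- An almost contact metric 3-structure on a manifold of dimension `4n+3`: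
three almost contact metric structures `(φ_α, ξ_α, η_α, g)` satisfying the
quaternionic-type relations, together with a (local) orthonormal frame. -/
class ACM3 (F V : Type) [CommRing F] [Algebra ℝ F] [AddCommGroup V] [Module F V]
    [SmoothSetting F V] where
  n : ℕ
  g : V → V → F
  phi : Fin 3 → V → V
  xi : Fin 3 → V
  eta : Fin 3 → V → F
  g_symm : ∀ X Y, g X Y = g Y X
  g_addLeft : ∀ X Y Z, g (X + Y) Z = g X Z + g Y Z
  g_smulLeft : ∀ (f : F) (X Y : V), g (f • X) Y = f * g X Y
  g_nondeg : ∀ X, (∀ Y, g X Y = 0) → X = 0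
  phi_add : ∀ α (X Y : V), phi α (X + Y) = phi α X + phi α Y
  phi_smul : ∀ α (f : F) (X : V), phi α (f • X) = f • phi α X
  eta_eq : ∀ α X, eta α X = g X (xi α)
  acm_sq : ∀ α X, phi α (phi α X) = -X + eta α X • xi α
  eta_xi : ∀ α, eta α (xi α) = 1
  compat : ∀ α X Y, g (phi α X) (phi α Y) = g X Y - eta α X * eta α Y
  quat_phi : ∀ a b c, Cyclic a b c → ∀ X, phi c X = phi a (phi b X) - eta b X • xi a
  quat_phi' : ∀ a b c, Cyclic a b c → ∀ X, phi c X = -(phi b (phi a X)) + eta a X • xi b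
  quat_xi : ∀ a b c, Cyclic a b c → xi c = phi a (xi b)
  quat_xi' : ∀ a b c, Cyclic a b c → xi c = -(phi b (xi a))
  quat_eta : ∀ a b c, Cyclic a b c → ∀ X, eta c X = eta a (phi b X)
  quat_eta' : ∀ a b c, Cyclic a b c → ∀ X, eta c X = -(eta b (phi a X))
  frame : Fin (4 * n + 3) → V
  frame_orth : ∀ i j, g (frame i) (frame j) = if i = j then 1 else 0
  frame_span : ∀ X : V, X = ∑ i, g X (frame i) • frame i

section acm

variable (F V : Type) [CommRing F] [Algebra ℝ F] [AddCommGroup V] [Module F V]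
  [SmoothSetting F V] [ACM3 F V]

/-- The integer `n` (the manifold has dimension `4n+3`). -/
def dimn : ℕ := ACM3.n F V

/-- The Riemannian metric. -/
def gm (X Y : V) : F := ACM3.g X Y

/-- The structure tensors `φ_α`. -/
def ph (α : Fin 3) (X : V) : V := ACM3.phi F α X

/-- The Reeb vector fields `ξ_α`. -/
def rxi (α : Fin 3) : V := ACM3.xi F α

/-- The 1-forms `η_α`. -/
def et (α : Fin 3) (X : V) : F := ACM3.eta α X

/-- The orthonormal frame. -/
def fr (i : Fin (4 * dimn F V + 3)) : V := ACM3.frame i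

/-- The fundamental 2-form `Φ_α(X,Y) = g(X, φ_α Y)`. -/
def Phi (α : Fin 3) (X Y : V) : F := gm F V X (ph F V α Y)

/-- The Nijenhuis torsion `[φ_α, φ_α]` of `φ_α`. -/
def Nij (α : Fin 3) (X Y : V) : V :=
  ph F V α (ph F V α (lie F V X Y)) + lie F V (ph F V α X) (ph F V α Y)
    - ph F V α (lie F V (ph F V α X) Y) - ph F V α (lie F V X (ph F V α Y))

/-- The normality tensor `N⁽¹⁾_α = [φ_α, φ_α] + 2 dη_α ⊗ ξ_α`. -/
def NOne (α : Fin 3) (X Y : V) : V :=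
  Nij F V α X Y + ((2 : ℝ) • dOne F V (et F V α) X Y) • rxi F V α

/-- The structure `(φ_α, ξ_α, η_α)` is normal. -/
def IsNormal (α : Fin 3) : Prop := ∀ X Y, NOne F V α X Y = 0

/-- A 2-form is closed. -/
def IsClosedTwo (ω : V → V → F) : Prop := ∀ X Y Z, dTwo F V ω X Y Z = 0

/-- The structure `(φ_α, ξ_α, η_α, g)` is quasi-Sasakian: normal with closed
fundamental 2-form. -/
def IsQuasiSasakian (α : Fin 3) : Prop :=
  IsNormal F V α ∧ IsClosedTwo F V (Phi F V α)

/-- `M` is 3-cosymplectic: each structure is normal with `dη_α = 0` and `dΦ_α = 0`. -/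
def ThreeCosymplectic : Prop :=
  ∀ α, IsNormal F V α ∧ (∀ X Y, dOne F V (et F V α) X Y = 0) ∧
    IsClosedTwo F V (Phi F V α)

/-- `M` is 3-α-Sasakian with constant `a ≠ 0`: each structure is normal (an
`α`-Sasakian structure) and `dη_δ = a Φ_δ`. -/
def Is3AlphaSasakianWith (a : ℝ) : Prop :=
  a ≠ 0 ∧ (∀ δ, IsNormal F V δ) ∧
    ∀ (δ : Fin 3) (X Y : V), dOne F V (et F V δ) X Y = algebraMap ℝ F a * Phi F V δ X Y

/-- A vector field is horizontal: it lies in `H = ∩_α ker η_α`. -/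
def Horiz (X : V) : Prop := ∀ α, et F V α X = 0

/-- A vector field is vertical: it lies in `V = ⟨ξ₁, ξ₂, ξ₃⟩`. -/
def InVert (X : V) : Prop :=
  ∃ p q r : F, X = p • rxi F V 0 + q • rxi F V 1 + r • rxi F V 2

/-- The distribution `E^{4m} = {X ∈ H : i_X dη_α = 0}`. -/
def InE4m (X : V) : Prop :=
  Horiz F V X ∧ ∀ (α : Fin 3) (Y : V), dOne F V (et F V α) X Y = 0

/-- The distribution `E^{4l}`: the orthogonal complement of `E^{4m}` in `H`. -/
def InE4l (X : V) : Prop :=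
  Horiz F V X ∧ ∀ Y, InE4m F V Y → gm F V X Y = 0

/-- The distribution `E^{4l+3} = E^{4l} ⊕ V`. -/
def InE4l3 (X : V) : Prop :=
  ∃ Y Z, InE4l F V Y ∧ InVert F V Z ∧ X = Y + Z

/-- The distribution `E^{4m+3} = E^{4m} ⊕ V`. -/
def InE4m3 (X : V) : Prop :=
  ∃ Y Z, InE4m F V Y ∧ InVert F V Z ∧ X = Y + Z

/-- The horizontal component `X_H = X - ∑_α η_α(X) ξ_α` of a vector field. -/
def horComp (X : V) : V := X - ∑ α : Fin 3, et F V α X • rxi F V α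

/-- A vector field is basic with respect to the foliation defined by `E^{4m}`. -/
def BasicE4m (X : V) : Prop :=
  InE4l3 F V X ∧ ∀ W, InE4m F V W → InE4m F V (lie F V W X)

/-- A vector field is basic with respect to the foliation defined by `E^{4l+3}`. -/
def BasicE4l3 (X : V) : Prop :=
  InE4m F V X ∧ ∀ W, InE4l3 F V W → InE4l3 F V (lie F V W X)

end acm

/-- A 3-quasi-Sasakian structure: each of the three almost contact metric
structures is quasi-Sasakian.  We also record, as part of the structure, the
standard structural facts established for such manifolds in the literature
(Cappelletti Montano–De Nicola–Dileo): the Reeb commutation relations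
`[ξ_α, ξ_β] = c ξ_γ`, the splitting `H = E^{4l} ⊕ E^{4m}` (constancy of the
rank), the `φ_α`-invariance of both distributions, and the tensors `ψ_α`
(equal to `φ_α` on `E^{4l+3}` and vanishing on `E^{4m}` when the rank is
`4l+3`, i.e. `c ≠ 0`; equal to `φ_α` on `E^{4l}` and vanishing on `E^{4m+3}`
when the rank is `4l+1`, i.e. `c = 0`). -/
class ThreeQS (F V : Type) [CommRing F] [Algebra ℝ F] [AddCommGroup V] [Module F V]
    [SmoothSetting F V] [ACM3 F V] where
  qs : ∀ α, IsQuasiSasakian F V α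
  c : ℝ
  reeb_bracket : ∀ a b c', Cyclic a b c' →
    lie F V (rxi F V a) (rxi F V b) = algebraMap ℝ F c • rxi F V c'
  horiz_split : ∀ X, Horiz F V X → ∃ Y Z, InE4l F V Y ∧ InE4m F V Z ∧ X = Y + Z
  phi_E4l : ∀ α X, InE4l F V X → InE4l F V (ph F V α X)
  phi_E4m : ∀ α X, InE4m F V X → InE4m F V (ph F V α X)
  psi : Fin 3 → V → V
  psi_add : ∀ α (X Y : V), psi α (X + Y) = psi α X + psi α Y
  psi_smul : ∀ α (f : F) (X : V), psi α (f • X) = f • psi α X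
  psi_E4l : ∀ α X, InE4l F V X → psi α X = ph F V α X
  psi_E4m : ∀ α X, InE4m F V X → psi α X = 0
  psi_vert_of_ne : c ≠ 0 → ∀ α β, psi α (rxi F V β) = ph F V α (rxi F V β)
  psi_vert_of_eq : c = 0 → ∀ α β, psi α (rxi F V β) = 0

section tqs

variable (F V : Type) [CommRing F] [Algebra ℝ F] [AddCommGroup V] [Module F V]
  [SmoothSetting F V] [ACM3 F V] [ThreeQS F V]

/-- The constant `c` with `[ξ_α, ξ_β] = c ξ_γ`. -/
def cc : ℝ := ThreeQS.c F V

/-- The tensors `ψ_α`. -/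
def psiT (α : Fin 3) (X : V) : V := ThreeQS.psi F α X

/-- The tensors `θ_α = φ_α - ψ_α`. -/
def thetaT (α : Fin 3) (X : V) : V := ph F V α X - psiT F V α X

/-- The 2-forms `Θ_α(X,Y) = g(X, θ_α Y)`. -/
def ThetaForm (α : Fin 3) (X Y : V) : F := gm F V X (thetaT F V α Y)

end tqs

/-- The 3-quasi-Sasakian manifold has rank `4l+3`: the constant `c` is nonzero
and the orthonormal frame is adapted to the splitting
`TM = E^{4l} ⊕ E^{4m} ⊕ ⟨ξ₁,ξ₂,ξ₃⟩` with `dim E^{4l} = 4l` (hence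
`dim E^{4m} = 4m`, `m = n - l`, and the rank of the `η_α` is `4l+3`). -/
class HasRank (F V : Type) [CommRing F] [Algebra ℝ F] [AddCommGroup V] [Module F V]
    [SmoothSetting F V] [ACM3 F V] [ThreeQS F V] (l : ℕ) : Prop where
  c_ne : cc F V ≠ 0
  l_le : l ≤ dimn F V
  frame_E4l : ∀ i : Fin (4 * dimn F V + 3), i.val < 4 * l → InE4l F V (fr F V i)
  frame_E4m : ∀ i : Fin (4 * dimn F V + 3), 4 * l ≤ i.val → i.val < 4 * dimn F V →
    InE4m F V (fr F V i)
  frame_xi : ∀ (i : Fin (4 * dimn F V + 3)) (a : Fin 3),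
    i.val = 4 * dimn F V + a.val → fr F V i = rxi F V a

/-- The Levi-Civita connection of `g`: the unique torsion-free metric connection. -/
class LeviCivita (F V : Type) [CommRing F] [Algebra ℝ F] [AddCommGroup V] [Module F V]
    [SmoothSetting F V] [ACM3 F V] where
  nabla : V → V → V
  nabla_addLeft : ∀ X Y Z : V, nabla (X + Y) Z = nabla X Z + nabla Y Z
  nabla_smulLeft : ∀ (f : F) (X Y : V), nabla (f • X) Y = f • nabla X Y
  nabla_addRight : ∀ X Y Z : V, nabla X (Y + Z) = nabla X Y + nabla X Z
  nabla_leibniz : ∀ (X : V) (f : F) (Y : V),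
    nabla X (f • Y) = der F V X f • Y + f • nabla X Y
  nabla_metric : ∀ X Y Z : V,
    der F V X (gm F V Y Z) = gm F V (nabla X Y) Z + gm F V Y (nabla X Z)
  nabla_torsionFree : ∀ X Y : V, nabla X Y - nabla Y X = lie F V X Y

section curv

variable (F V : Type) [CommRing F] [Algebra ℝ F] [AddCommGroup V] [Module F V]
  [SmoothSetting F V] [ACM3 F V] [LeviCivita F V]

/-- The Levi-Civita covariant derivative `∇_X Y`. -/
def nab (X Y : V) : V := LeviCivita.nabla F X Y

/-- The Riemannian curvature `R(X,Y)Z = ∇_X ∇_Y Z - ∇_Y ∇_X Z - ∇_{[X,Y]} Z`. -/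
def Rcurv (X Y Z : V) : V :=
  nab F V X (nab F V Y Z) - nab F V Y (nab F V X Z) - nab F V (lie F V X Y) Z

/-- The Ricci tensor `Ric(X,Y) = ∑_i g(R(e_i, X)Y, e_i)`. -/
def Ric (X Y : V) : F :=
  ∑ i, gm F V (Rcurv F V (fr F V i) X Y) (fr F V i)

/-- The scalar curvature. -/
def Scal : F := ∑ i, Ric F V (fr F V i) (fr F V i)

/-- `M` is Einstein: `Ric = a g` for a constant `a`. -/
def Einstein : Prop :=
  ∃ a : ℝ, ∀ X Y, Ric F V X Y = algebraMap ℝ F a * gm F V X Y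

/-- `M` is η-Einstein: `Ric = a g + b ∑_α η_α ⊗ η_α` for constants `a, b`. -/
def EtaEinstein : Prop :=
  ∃ a b : ℝ, ∀ X Y, Ric F V X Y
    = algebraMap ℝ F a * gm F V X Y
      + algebraMap ℝ F b * ∑ α : Fin 3, et F V α X * et F V α Y

end curv

/-- A (Koszul) linear connection on vector fields. -/
def IsConnection (F V : Type) [CommRing F] [Algebra ℝ F] [AddCommGroup V] [Module F V]
    [SmoothSetting F V] (D : V → V → V) : Prop :=
  (∀ X Y Z : V, D (X + Y) Z = D X Z + D Y Z) ∧
  (∀ (f : F) (X Y : V), D (f • X) Y = f • D X Y) ∧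
  (∀ X Y Z : V, D X (Y + Z) = D X Y + D X Z) ∧
  (∀ (X : V) (f : F) (Y : V), D X (f • Y) = der F V X f • Y + f • D X Y)

end QS3

namespace QS3

section lemmas

variable {F V : Type} [CommRing F] [Algebra ℝ F] [AddCommGroup V] [Module F V]

lemma algebraMap_half_add_half :
    algebraMap ℝ F (1 / 2) + algebraMap ℝ F (1 / 2) = 1 := by
  rw [← map_add]; norm_num

lemma eq_zero_of_add_self {x : F} (h : x + x = 0) : x = 0 := by
  linear_combination (algebraMap ℝ F (1 / 2)) * h - x * algebraMap_half_add_half (F := F)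

lemma eq_zero_of_add_self' (F : Type) {V : Type} [CommRing F] [Algebra ℝ F] [AddCommGroup V]
    [Module F V] {x : V} (h : x + x = 0) : x = 0 := by
  rw [← one_smul F x, ← algebraMap_half_add_half, add_smul, ← smul_add, h, smul_zero]

lemma Cyclic.rotate {a b c : Fin 3} (h : Cyclic a b c) : Cyclic b c a := by
  simp only [Cyclic, Prod.mk.injEq] at *
  tauto

lemma exists_cyclic (a : Fin 3) : ∃ b c, Cyclic a b c := by
  fin_cases a
  exacts [⟨1, 2, Or.inl rfl⟩, ⟨2, 0, Or.inr (Or.inl rfl)⟩, ⟨0, 1, Or.inr (Or.inr rfl)⟩]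

section calculus

variable [SmoothSetting F V]

lemma der_add (X : V) (f h : F) : der F V X (f + h) = der F V X f + der F V X h :=
  SmoothSetting.act_add X f h

lemma der_zero (X : V) : der F V X 0 = 0 := by
  simpa using der_add (F := F) X 0 0

lemma der_neg (X : V) (f : F) : der F V X (-f) = -der F V X f := by
  have h := der_add X f (-f)
  rw [add_neg_cancel, der_zero] at h
  linear_combination -h

lemma der_sub (X : V) (f h : F) : der F V X (f - h) = der F V X f - der F V X h := by
  rw [sub_eq_add_neg, der_add, der_neg, ← sub_eq_add_neg]

lemma der_mul (X : V) (f h : F) : der F V X (f * h) = der F V X f * h + f * der F V X h :=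
  SmoothSetting.act_mul X f h

lemma der_const (X : V) (r : ℝ) : der F V X (algebraMap ℝ F r) = 0 :=
  SmoothSetting.act_const X r

lemma der_one (X : V) : der F V X 1 = 0 := by
  simpa using der_const (F := F) X 1

lemma lie_antisymm (X Y : V) : lie F V X Y = -lie F V Y X :=
  SmoothSetting.bracket_antisymm X Y

lemma lie_add_left (X Y Z : V) : lie F V (X + Y) Z = lie F V X Z + lie F V Y Z :=
  SmoothSetting.bracket_addLeft X Y Z

lemma lie_add_right (X Y Z : V) : lie F V X (Y + Z) = lie F V X Y + lie F V X Z := by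
  rw [lie_antisymm, lie_add_left, lie_antisymm Y, lie_antisymm Z]; abel

lemma lie_zero (X : V) : lie F V X 0 = 0 := by
  simpa using lie_add_right (F := F) X 0 0

lemma lie_neg (X Y : V) : lie F V X (-Y) = -lie F V X Y := by
  rw [eq_neg_iff_add_eq_zero, ← lie_add_right, neg_add_cancel, lie_zero]

lemma lie_sub (X Y Z : V) : lie F V X (Y - Z) = lie F V X Y - lie F V X Z := by
  rw [sub_eq_add_neg, lie_add_right, lie_neg, ← sub_eq_add_neg]

lemma lie_smul (X : V) (f : F) (Y : V) :
    lie F V X (f • Y) = f • lie F V X Y + der F V X f • Y :=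
  SmoothSetting.bracket_smulRight X f Y

lemma lie_self_eq_zero (X : V) : lie F V X X = 0 :=
  eq_zero_of_add_self' F (by nth_rw 1 [lie_antisymm]; exact neg_add_cancel _)

lemma lie_const_smul_left (r : ℝ) (X Y : V) :
    lie F V (algebraMap ℝ F r • X) Y = algebraMap ℝ F r • lie F V X Y := by
  rw [lie_antisymm, lie_smul, der_const, zero_smul, add_zero, lie_antisymm Y, smul_neg, neg_neg]

lemma lie_lie (X Y Z : V) :
    lie F V X (lie F V Y Z) - lie F V Y (lie F V X Z) = lie F V (lie F V X Y) Z := by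
  have h : lie F V X (lie F V Y Z) + lie F V Y (lie F V Z X) + lie F V Z (lie F V X Y) = 0 :=
    SmoothSetting.jacobi X Y Z
  rw [lie_antisymm Z X, lie_neg, lie_antisymm Z] at h
  rw [← sub_eq_zero, ← h]; abel

end calculus

section acm

variable [SmoothSetting F V] [ACM3 F V]

lemma gm_comm (X Y : V) : gm F V X Y = gm F V Y X := ACM3.g_symm X Y

lemma gm_add_left (X Y Z : V) : gm F V (X + Y) Z = gm F V X Z + gm F V Y Z :=
  ACM3.g_addLeft X Y Z

lemma gm_smul_left (f : F) (X Y : V) : gm F V (f • X) Y = f * gm F V X Y :=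
  ACM3.g_smulLeft f X Y

lemma gm_neg_left (X Y : V) : gm F V (-X) Y = -gm F V X Y := by
  rw [← neg_one_smul F, gm_smul_left]; ring

lemma gm_sub_left (X Y Z : V) : gm F V (X - Y) Z = gm F V X Z - gm F V Y Z := by
  rw [sub_eq_add_neg, gm_add_left, gm_neg_left, ← sub_eq_add_neg]

lemma gm_add_right (X Y Z : V) : gm F V X (Y + Z) = gm F V X Y + gm F V X Z := by
  rw [gm_comm, gm_add_left, gm_comm Y, gm_comm Z]

lemma gm_smul_right (f : F) (X Y : V) : gm F V X (f • Y) = f * gm F V X Y := by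
  rw [gm_comm, gm_smul_left, gm_comm Y]

lemma gm_neg_right (X Y : V) : gm F V X (-Y) = -gm F V X Y := by
  rw [gm_comm, gm_neg_left, gm_comm Y]

lemma gm_sub_right (X Y Z : V) : gm F V X (Y - Z) = gm F V X Y - gm F V X Z := by
  rw [gm_comm, gm_sub_left, gm_comm Y, gm_comm Z]

lemma eq_of_gm_left {X Y : V} (h : ∀ Z, gm F V Z X = gm F V Z Y) : X = Y := by
  refine sub_eq_zero.mp (ACM3.g_nondeg (F := F) (X - Y) fun Z => ?_)
  change gm F V (X - Y) Z = 0
  rw [gm_sub_left, gm_comm X, gm_comm Y, h, sub_self]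

lemma et_eq_gm (a : Fin 3) (X : V) : et F V a X = gm F V X (rxi F V a) := ACM3.eta_eq a X

lemma et_add (a : Fin 3) (X Y : V) : et F V a (X + Y) = et F V a X + et F V a Y := by
  simp only [et_eq_gm, gm_add_left]

lemma et_neg (a : Fin 3) (X : V) : et F V a (-X) = -et F V a X := by
  simp only [et_eq_gm, gm_neg_left]

lemma et_sub (a : Fin 3) (X Y : V) : et F V a (X - Y) = et F V a X - et F V a Y := by
  simp only [et_eq_gm, gm_sub_left]

lemma et_smul (a : Fin 3) (f : F) (X : V) : et F V a (f • X) = f * et F V a X := by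
  simp only [et_eq_gm, gm_smul_left]

lemma et_zero (a : Fin 3) : et F V a 0 = 0 := by
  simpa using et_smul (F := F) (V := V) a 0 0

lemma ph_add (a : Fin 3) (X Y : V) : ph F V a (X + Y) = ph F V a X + ph F V a Y :=
  ACM3.phi_add a X Y

lemma ph_smul (a : Fin 3) (f : F) (X : V) : ph F V a (f • X) = f • ph F V a X :=
  ACM3.phi_smul a f X

lemma ph_neg (a : Fin 3) (X : V) : ph F V a (-X) = -ph F V a X := by
  rw [← neg_one_smul F, ph_smul, neg_one_smul]

lemma ph_sub (a : Fin 3) (X Y : V) : ph F V a (X - Y) = ph F V a X - ph F V a Y := by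
  rw [sub_eq_add_neg, ph_add, ph_neg, ← sub_eq_add_neg]

lemma ph_zero (a : Fin 3) : ph F V a 0 = 0 := by
  simpa using ph_smul (F := F) (V := V) a 0 0

lemma ph_ph (a : Fin 3) (X : V) :
    ph F V a (ph F V a X) = -X + et F V a X • rxi F V a :=
  ACM3.acm_sq a X

lemma et_rxi_self (a : Fin 3) : et F V a (rxi F V a) = 1 := ACM3.eta_xi a

lemma gm_ph_ph (a : Fin 3) (X Y : V) :
    gm F V (ph F V a X) (ph F V a Y) = gm F V X Y - et F V a X * et F V a Y :=
  ACM3.compat a X Y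

variable {a b c : Fin 3}

lemma Cyclic.ph_eq (h : Cyclic a b c) (X : V) :
    ph F V c X = ph F V a (ph F V b X) - et F V b X • rxi F V a :=
  ACM3.quat_phi a b c h X

lemma Cyclic.ph_eq' (h : Cyclic a b c) (X : V) :
    ph F V c X = -ph F V b (ph F V a X) + et F V a X • rxi F V b :=
  ACM3.quat_phi' a b c h X

lemma Cyclic.ph_rxi (h : Cyclic a b c) : ph F V a (rxi F V b) = rxi F V c :=
  (ACM3.quat_xi a b c h).symm

lemma Cyclic.ph_rxi' (h : Cyclic a b c) : ph F V b (rxi F V a) = -rxi F V c := by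
  have h' : rxi F V c = -ph F V b (rxi F V a) := ACM3.quat_xi' a b c h
  rw [h', neg_neg]

lemma Cyclic.et_ph (h : Cyclic a b c) (X : V) : et F V a (ph F V b X) = et F V c X :=
  (ACM3.quat_eta a b c h X).symm

lemma Cyclic.et_ph' (h : Cyclic a b c) (X : V) : et F V b (ph F V a X) = -et F V c X := by
  have h' : et F V c X = -et F V b (ph F V a X) := ACM3.quat_eta' a b c h X
  rw [h', neg_neg]

lemma et_rxi_comm (a b : Fin 3) : et F V a (rxi F V b) = et F V b (rxi F V a) := by
  rw [et_eq_gm, et_eq_gm, gm_comm]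

lemma Cyclic.et_rxi (h : Cyclic a b c) : et F V a (rxi F V b) = 0 := by
  refine eq_zero_of_add_self ?_
  have h₁ := h.rotate.et_ph (F := F) (rxi F V b)
  rw [h.rotate.ph_rxi', et_neg, et_rxi_comm b a] at h₁
  linear_combination -h₁

lemma Cyclic.et_rxi' (h : Cyclic a b c) : et F V b (rxi F V a) = 0 := by
  rw [et_rxi_comm, h.et_rxi]

lemma ph_rxi_self (a : Fin 3) : ph F V a (rxi F V a) = 0 := by
  obtain ⟨b, c, h⟩ := exists_cyclic a
  have h₀ : et F V a (ph F V a (rxi F V a)) = 0 := by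
    have h₁ := h.rotate.rotate.ph_eq (F := F) (rxi F V a)
    rw [h.ph_rxi', et_rxi_self, one_smul] at h₁
    rw [← h.rotate.et_ph, eq_add_of_sub_eq h₁.symm, neg_add_cancel, et_zero]
  have h₁ := ph_ph (F := F) a (rxi F V a)
  rw [et_rxi_self, one_smul, neg_add_cancel] at h₁
  have h₂ := ph_ph (F := F) a (ph F V a (rxi F V a))
  rw [h₁, ph_zero, h₀, zero_smul, add_zero] at h₂
  exact neg_eq_zero.mp h₂.symm

lemma et_ph_self (a : Fin 3) (X : V) : et F V a (ph F V a X) = 0 := by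
  have h₁ := ph_ph (F := F) a (ph F V a X)
  rw [ph_ph (F := F) a X, ph_add, ph_neg, ph_smul, ph_rxi_self, smul_zero, add_zero] at h₁
  have h₂ := congrArg (et F V a) h₁
  simp only [et_add, et_neg, et_smul, et_rxi_self] at h₂
  linear_combination -h₂

lemma gm_ph_left (a : Fin 3) (X Y : V) :
    gm F V (ph F V a X) Y = -gm F V X (ph F V a Y) := by
  have h := gm_ph_ph (F := F) a X (ph F V a Y)
  rw [ph_ph, gm_add_right, gm_neg_right, gm_smul_right, et_ph_self, ← et_eq_gm, et_ph_self] at h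
  linear_combination -h

variable (F) in
/-- The Lie derivative `(L_{ξ_a} φ_b) X = [ξ_a, φ_b X] - φ_b [ξ_a, X]`. -/
def liePh (a b : Fin 3) (X : V) : V :=
  lie F V (rxi F V a) (ph F V b X) - ph F V b (lie F V (rxi F V a) X)

lemma lie_rxi_ph (a b : Fin 3) (X : V) :
    lie F V (rxi F V a) (ph F V b X)
      = liePh F a b X + ph F V b (lie F V (rxi F V a) X) := by
  rw [liePh, sub_add_cancel]

lemma liePh_sub (a b : Fin 3) (X Y : V) :
    liePh F a b (X - Y) = liePh F a b X - liePh F a b Y := by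
  simp only [liePh, ph_sub, lie_sub]; abel

lemma liePh_const_smul (a b : Fin 3) (r : ℝ) (X : V) :
    liePh F a b (algebraMap ℝ F r • X) = algebraMap ℝ F r • liePh F a b X := by
  simp only [liePh, ph_smul, lie_smul, der_const, zero_smul, add_zero, smul_sub]

variable (F) in
/-- The exterior differential of `η_a` without the normalizing factor `1/2`. -/
def twoDEt (a : Fin 3) (X Y : V) : F :=
  der F V X (et F V a Y) - der F V Y (et F V a X) - et F V a (lie F V X Y)

lemma dOne_et (a : Fin 3) (X Y : V) :
    dOne F V (et F V a) X Y = algebraMap ℝ F 2⁻¹ * twoDEt F a X Y :=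
  Algebra.smul_def _ _

lemma IsNormal.eq (hN : IsNormal F V a) (X : V) :
    ph F V a (ph F V a (lie F V X (rxi F V a))) - ph F V a (lie F V (ph F V a X) (rxi F V a))
      + twoDEt F a X (rxi F V a) • rxi F V a = 0 := by
  have h := hN X (rxi F V a)
  rw [NOne, Nij, dOne_et, Algebra.smul_def, ← mul_assoc, ← map_mul, mul_inv_cancel₀ two_ne_zero,
    map_one, one_mul, ph_rxi_self, lie_zero, lie_zero, ph_zero, add_zero, sub_zero] at h
  exact h

lemma IsNormal.twoDEt_rxi (hN : IsNormal F V a) (X : V) : twoDEt F a X (rxi F V a) = 0 := by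
  have h := congrArg (et F V a) (hN.eq X)
  rw [et_add, et_sub, et_ph_self, et_ph_self, et_smul, et_rxi_self, et_zero] at h
  linear_combination h

/-- `L_ξ η = 0` for a normal structure. -/
lemma IsNormal.der_et (hN : IsNormal F V a) (X : V) :
    der F V (rxi F V a) (et F V a X) = et F V a (lie F V (rxi F V a) X) := by
  have h := hN.twoDEt_rxi X
  rw [twoDEt, et_rxi_self, der_one, lie_antisymm, et_neg] at h
  linear_combination -h

/-- `L_ξ φ = 0` for a normal structure. -/
lemma IsNormal.lie_ph (hN : IsNormal F V a) (X : V) :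
    lie F V (rxi F V a) (ph F V a X) = ph F V a (lie F V (rxi F V a) X) := by
  have h := congrArg (ph F V a) (hN.eq X)
  have h₁ : et F V a (lie F V (ph F V a X) (rxi F V a)) = 0 := by
    rw [lie_antisymm, et_neg, ← hN.der_et, et_ph_self, der_zero, neg_zero]
  have h₂ := ph_ph (F := F) a (ph F V a (lie F V X (rxi F V a)))
  rw [et_ph_self, zero_smul, add_zero] at h₂
  rw [ph_add, ph_sub, h₂, ph_ph, h₁, zero_smul, add_zero, ph_smul, ph_rxi_self, smul_zero, add_zero,
    ph_zero, lie_antisymm X, lie_antisymm (ph F V a X), ph_neg, neg_neg, neg_neg] at h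
  exact (sub_eq_zero.mp h).symm

lemma IsClosedTwo.lie_Phi (h : IsClosedTwo F V (Phi F V b)) (X Y Z : V) :
    der F V X (Phi F V b Y Z) + der F V Y (Phi F V b Z X) + der F V Z (Phi F V b X Y)
      - Phi F V b (lie F V X Y) Z - Phi F V b (lie F V Y Z) X
      - Phi F V b (lie F V Z X) Y = 0 := by
  have h₁ := h X Y Z
  rw [dTwo] at h₁
  exact (smul_eq_zero_iff_right (by norm_num : (3 : ℝ)⁻¹ ≠ 0)).mp h₁

/-- The Reeb vector field of a quasi-Sasakian structure is Killing. -/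
lemma IsQuasiSasakian.killing (hQ : IsQuasiSasakian F V a) (X Y : V) :
    der F V (rxi F V a) (gm F V X Y)
      = gm F V (lie F V (rxi F V a) X) Y + gm F V X (lie F V (rxi F V a) Y) := by
  have key (Z : V) : der F V (rxi F V a) (gm F V X (ph F V a Z))
      = gm F V (lie F V (rxi F V a) X) (ph F V a Z)
        + gm F V X (lie F V (rxi F V a) (ph F V a Z)) := by
    have h := hQ.2.lie_Phi (rxi F V a) X Z
    have h₀ (W : V) : Phi F V a W (rxi F V a) = 0 := by
      rw [Phi, ph_rxi_self, gm_comm, ← zero_smul F (0 : V), gm_smul_left, zero_mul]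
    have h₁ (W : V) : Phi F V a (rxi F V a) W = 0 := by
      rw [Phi, gm_comm, ← et_eq_gm, et_ph_self]
    rw [h₀, h₁, h₀, der_zero, der_zero, lie_antisymm Z] at h
    simp only [Phi, gm_neg_left] at h
    rw [gm_comm _ (ph F V a X), gm_ph_left] at h
    rw [hQ.1.lie_ph]
    linear_combination h
  have hY : Y = et F V a Y • rxi F V a - ph F V a (ph F V a Y) := by rw [ph_ph]; abel
  have h₁ := key (ph F V a Y)
  have h₂ := hQ.1.der_et X
  rw [et_eq_gm, et_eq_gm] at h₂
  rw [hY, lie_sub, lie_smul, lie_self_eq_zero, smul_zero, zero_add, gm_sub_right, gm_sub_right,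
    gm_sub_right, gm_smul_right, gm_smul_right, gm_smul_right, der_sub, der_mul]
  linear_combination -h₁ + et F V a Y * h₂

end acm

section threeQS

variable [SmoothSetting F V] [ACM3 F V] [ThreeQS F V] {a b c : Fin 3}

lemma Cyclic.lie_rxi (h : Cyclic a b c) :
    lie F V (rxi F V a) (rxi F V b) = algebraMap ℝ F (cc F V) • rxi F V c :=
  ThreeQS.reeb_bracket (F := F) a b c h

lemma Cyclic.lie_rxi' (h : Cyclic a b c) :
    lie F V (rxi F V a) (rxi F V c) = -(algebraMap ℝ F (cc F V) • rxi F V b) := by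
  rw [lie_antisymm, h.rotate.rotate.lie_rxi]

lemma isQuasiSasakian (a : Fin 3) : IsQuasiSasakian F V a := ThreeQS.qs a

lemma Cyclic.der_rxi_et (h : Cyclic a b c) (X : V) :
    der F V (rxi F V a) (et F V b X)
      = et F V b (lie F V (rxi F V a) X) + algebraMap ℝ F (cc F V) * et F V c X := by
  rw [et_eq_gm b X, (isQuasiSasakian a).killing, h.lie_rxi, gm_smul_right, ← et_eq_gm, ← et_eq_gm]

lemma Cyclic.der_rxi_et' (h : Cyclic a b c) (X : V) :
    der F V (rxi F V a) (et F V c X)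
      = et F V c (lie F V (rxi F V a) X) - algebraMap ℝ F (cc F V) * et F V b X := by
  rw [et_eq_gm c X, (isQuasiSasakian a).killing, h.lie_rxi', gm_neg_right, gm_smul_right,
    ← et_eq_gm, ← et_eq_gm, sub_eq_add_neg]

lemma gm_liePh (a b : Fin 3) (Y Z : V) :
    gm F V Y (liePh F a b Z)
      = -der F V Y (Phi F V b Z (rxi F V a)) - der F V Z (Phi F V b (rxi F V a) Y)
        + Phi F V b (lie F V Y Z) (rxi F V a) := by
  have h₁ := (isQuasiSasakian (F := F) (V := V) b).2.lie_Phi (rxi F V a) Y Z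
  have h₂ := (isQuasiSasakian (F := F) a).killing Y (ph F V b Z)
  have h₃ : Phi F V b (lie F V Z (rxi F V a)) Y
      = gm F V Y (ph F V b (lie F V (rxi F V a) Z)) := by
    rw [Phi, gm_comm, gm_ph_left, lie_antisymm, ph_neg, gm_neg_right, neg_neg]
  rw [h₃] at h₁
  rw [liePh, gm_sub_right]
  simp only [Phi] at h₁ ⊢
  linear_combination h₁ - h₂

/-- `L_{ξ_a} Φ_b = 2 dη_c`. -/
lemma Cyclic.gm_liePh (h : Cyclic a b c) (Y Z : V) :
    gm F V Y (liePh F a b Z) = twoDEt F c Y Z := by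
  rw [QS3.gm_liePh]
  simp only [Phi]
  rw [h.ph_rxi', gm_neg_right, gm_neg_right, gm_comm (rxi F V a), ← et_eq_gm, ← et_eq_gm,
    ← et_eq_gm, h.et_ph, der_neg, twoDEt]
  ring

lemma Cyclic.gm_liePh' (h : Cyclic a b c) (Y Z : V) :
    gm F V Y (liePh F a c Z) = -twoDEt F b Y Z := by
  rw [QS3.gm_liePh]
  simp only [Phi]
  rw [h.rotate.rotate.ph_rxi, gm_comm (rxi F V a), ← et_eq_gm, ← et_eq_gm,
    ← et_eq_gm, h.rotate.rotate.et_ph', der_neg, twoDEt]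
  ring

/-- `L_{ξ_a} φ_c = -L_{ξ_c} φ_a`. -/
lemma Cyclic.liePh_swap (h : Cyclic a b c) (X : V) : liePh F a c X = -liePh F c a X := by
  refine eq_of_gm_left (F := F) fun Y => ?_
  rw [h.gm_liePh', gm_neg_right, h.rotate.rotate.gm_liePh]

lemma liePh_self (a : Fin 3) (X : V) : liePh F a a X = 0 := by
  rw [liePh, (isQuasiSasakian a).1.lie_ph, sub_self]

lemma Cyclic.liePh_eq_ph_liePh (h : Cyclic a b c) (X : V) :
    liePh F a b X = ph F V a (liePh F c a X)
      - (algebraMap ℝ F (cc F V) * et F V b X) • rxi F V a := by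
  have h₁ := lie_rxi_ph (F := F) a b X
  have h₃ := h.rotate.rotate.ph_eq' (F := F) X
  have h₄ := h.rotate.rotate.ph_eq' (F := F) (lie F V (rxi F V a) X)
  rw [h₄, h₃, lie_add_right, lie_neg, lie_rxi_ph, liePh_self, zero_add, lie_rxi_ph, h.liePh_swap,
    lie_smul, lie_self_eq_zero, h.der_rxi_et', ph_add, ph_neg] at h₁
  rw [← sub_eq_iff_eq_add] at h₁
  rw [← h₁]
  module

lemma Cyclic.liePh_eq_liePh_ph (h : Cyclic a b c) (X : V) :
    liePh F a b X = -liePh F c a (ph F V a X)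
      + (algebraMap ℝ F (cc F V) * et F V a X) • rxi F V b := by
  have h₁ := lie_rxi_ph (F := F) a b X
  have h₃ := h.rotate.rotate.ph_eq (F := F) X
  have h₄ := h.rotate.rotate.ph_eq (F := F) (lie F V (rxi F V a) X)
  rw [h₄, h₃, lie_sub, lie_rxi_ph, h.liePh_swap, lie_rxi_ph, liePh_self, zero_add,
    lie_smul, h.lie_rxi', (isQuasiSasakian a).1.der_et] at h₁
  rw [← sub_eq_iff_eq_add] at h₁
  rw [← h₁]
  module

lemma Cyclic.liePh_eq_neg_ph_liePh (h : Cyclic a b c) (X : V) :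
    liePh F c a X = -ph F V a (liePh F a b X)
      + (algebraMap ℝ F (cc F V) * et F V c X) • rxi F V a := by
  have h₁ := lie_rxi_ph (F := F) a c X
  have h₃ := h.ph_eq (F := F) X
  have h₄ := h.ph_eq (F := F) (lie F V (rxi F V a) X)
  rw [h₄, h₃, lie_sub, lie_rxi_ph, liePh_self, zero_add, lie_rxi_ph, ph_add, h.liePh_swap,
    lie_smul, lie_self_eq_zero, h.der_rxi_et] at h₁
  rw [← sub_eq_iff_eq_add, eq_neg_iff_add_eq_zero] at h₁
  rw [eq_comm, ← sub_eq_zero, ← neg_eq_zero, ← h₁]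
  module

variable (F) in
/-- The second Lie derivative `(L_{ξ_a} L_{ξ_b} φ_d) X`. -/
def lieLiePh (a b d : Fin 3) (X : V) : V :=
  lie F V (rxi F V a) (liePh F b d X) - liePh F b d (lie F V (rxi F V a) X)

lemma Cyclic.lieLiePh_sub (h : Cyclic a b c) (d : Fin 3) (X : V) :
    lieLiePh F a b d X - lieLiePh F b a d X = algebraMap ℝ F (cc F V) • liePh F c d X := by
  have h₁ := lie_lie (F := F) (rxi F V a) (rxi F V b) (ph F V d X)
  have h₂ := congrArg (ph F V d) (lie_lie (F := F) (rxi F V a) (rxi F V b) X)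
  rw [h.lie_rxi, lie_const_smul_left] at h₁ h₂
  rw [ph_sub, ph_smul] at h₂
  simp only [lieLiePh, liePh, lie_sub]
  rw [smul_sub, ← h₁, ← h₂]
  abel

lemma lieLiePh_self (a b : Fin 3) (X : V) : lieLiePh F a b b X = 0 := by
  simp only [lieLiePh, liePh_self, lie_zero, sub_zero]

lemma Cyclic.lieLiePh_swap (h : Cyclic a b c) (d : Fin 3) (X : V) :
    lieLiePh F d a c X = -lieLiePh F d c a X := by
  simp only [lieLiePh, h.liePh_swap, lie_neg]; abel

/-- `L_{ξ_c} L_{ξ_a} φ_b = -L_{ξ_a} L_{ξ_b} φ_c`. -/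
lemma Cyclic.lieLiePh_rotate (h : Cyclic a b c) (X : V) :
    lieLiePh F a b c X = -lieLiePh F b c a X := by
  have h₁ := h.lieLiePh_sub (F := F) c X
  rw [liePh_self, smul_zero, sub_eq_zero] at h₁
  rw [h₁, h.lieLiePh_swap]

/-- `L_{ξ_a} dη_a = 0`. -/
lemma Cyclic.lieLiePh_eq_zero (h : Cyclic a b c) (X : V) : lieLiePh F a b c X = 0 := by
  refine eq_zero_of_add_self' F ?_
  nth_rw 1 [h.lieLiePh_rotate, h.rotate.lieLiePh_rotate, h.rotate.rotate.lieLiePh_rotate]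
  rw [neg_neg, neg_add_cancel]

lemma Cyclic.lieLiePh_eq (h : Cyclic a b c) (X : V) :
    lieLiePh F a c a X = algebraMap ℝ F (cc F V) • liePh F a b X := by
  have h₁ := h.rotate.rotate.lieLiePh_sub (F := F) a X
  rw [lieLiePh_self, zero_sub, h.rotate.liePh_swap, smul_neg] at h₁
  exact neg_injective h₁

lemma Cyclic.liePh_liePh (h : Cyclic a b c) (X : V) :
    liePh F c a (liePh F b c X) = algebraMap ℝ F (cc F V) • liePh F c a (ph F V a X) := by
  have h₁ := h.lieLiePh_eq (F := F) X
  have h₂ := h.lieLiePh_eq_zero (F := F) X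
  rw [lieLiePh, sub_eq_zero] at h₂
  rw [lieLiePh, h.rotate.rotate.liePh_eq_ph_liePh, h.rotate.rotate.liePh_eq_ph_liePh, lie_sub,
    lie_rxi_ph, h₂, h.liePh_swap, lie_smul, der_mul, der_const, (isQuasiSasakian a).1.der_et,
    h.lie_rxi', h.liePh_eq_liePh_ph, ← sub_eq_zero] at h₁
  rw [← sub_eq_zero, ← neg_eq_zero, ← h₁]
  module

lemma Cyclic.horiz_liePh_sub (h : Cyclic a b c) (X : V) :
    Horiz F V (liePh F b c X - algebraMap ℝ F (cc F V) • ph F V a X) := by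
  have ha : et F V a (liePh F b c X - algebraMap ℝ F (cc F V) • ph F V a X) = 0 := by
    rw [et_sub, et_smul, et_ph_self, et_eq_gm, gm_comm, h.rotate.gm_liePh, twoDEt, et_rxi_self,
      der_one, (isQuasiSasakian a).1.der_et]
    ring
  have hb : et F V b (liePh F b c X - algebraMap ℝ F (cc F V) • ph F V a X) = 0 := by
    rw [et_sub, et_smul, h.et_ph', et_eq_gm, gm_comm, h.rotate.gm_liePh, twoDEt, h.et_rxi,
      der_zero, h.rotate.der_rxi_et']
    ring
  have hc : et F V c (liePh F b c X - algebraMap ℝ F (cc F V) • ph F V a X) = 0 := by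
    rw [et_sub, et_smul, h.rotate.rotate.et_ph, et_eq_gm, gm_comm, h.rotate.gm_liePh, twoDEt,
      h.rotate.rotate.et_rxi', der_zero, h.rotate.rotate.der_rxi_et]
    ring
  intro d
  have hd : d = a ∨ d = b ∨ d = c := by
    simp only [Cyclic, Prod.mk.injEq] at h
    omega
  rcases hd with rfl | rfl | rfl <;> assumption

lemma Cyclic.inE4m_liePh_sub (h : Cyclic a b c) (X : V) :
    InE4m F V (liePh F b c X - algebraMap ℝ F (cc F V) • ph F V a X) := by
  have hH := h.horiz_liePh_sub (F := F) X
  refine ⟨hH, fun d Y => ?_⟩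
  have hb := h.liePh_liePh (F := F) X
  rw [← liePh_const_smul, ← sub_eq_zero, ← liePh_sub] at hb
  generalize liePh F b c X - algebraMap ℝ F (cc F V) • ph F V a X = U at *
  have ha : liePh F b c U = 0 := by
    rw [h.rotate.rotate.liePh_eq_neg_ph_liePh, hb, hH, mul_zero, zero_smul, ph_zero, neg_zero,
      add_zero]
  have hc : liePh F a b U = 0 := by
    rw [h.liePh_eq_ph_liePh, hb, hH, mul_zero, zero_smul, ph_zero, sub_zero]
  have key {p q r : Fin 3} (hc : Cyclic p q r) (hU : liePh F p q U = 0) :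
      dOne F V (et F V r) U Y = 0 := by
    have h₁ := hc.gm_liePh (F := F) Y U
    rw [hU, ← zero_smul F (0 : V), gm_smul_right, zero_mul] at h₁
    have h₂ : twoDEt F r U Y = -twoDEt F r Y U := by
      rw [twoDEt, twoDEt, lie_antisymm, et_neg]; ring
    rw [dOne_et, h₂, ← h₁, neg_zero, mul_zero]
  have hd : d = a ∨ d = b ∨ d = c := by
    simp only [Cyclic, Prod.mk.injEq] at h
    omega
  rcases hd with rfl | rfl | rfl
  exacts [key h.rotate ha, key h.rotate.rotate hb, key h hc]

lemma InE4m.eq_zero [HasRank F V (dimn F V)] {X : V} (hX : InE4m F V X) : X = 0 := by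
  have h (i : Fin (4 * dimn F V + 3)) : gm F V X (fr F V i) = 0 := by
    rcases lt_or_ge i.val (4 * dimn F V) with hi | hi
    · rw [gm_comm]
      exact (HasRank.frame_E4l i hi).2 X hX
    · rw [HasRank.frame_xi (l := dimn F V) i ⟨i.val - 4 * dimn F V, by omega⟩
        (by simp only; omega), ← et_eq_gm]
      exact hX.1 _
  have hs : X = ∑ i, gm F V X (fr F V i) • fr F V i := ACM3.frame_span X
  rw [hs]
  exact Finset.sum_eq_zero fun i _ => by rw [h, zero_smul]

lemma Cyclic.dOne_et_eq [HasRank F V (dimn F V)] (h : Cyclic a b c) (X Y : V) :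
    dOne F V (et F V a) X Y = algebraMap ℝ F (cc F V / 2) * Phi F V a X Y := by
  rw [dOne_et, ← h.rotate.gm_liePh, sub_eq_zero.mp (h.inE4m_liePh_sub Y).eq_zero, gm_smul_right,
    ← mul_assoc, ← map_mul, inv_mul_eq_div, Phi]

end threeQS

end lemmas

/-- Every 3-quasi-Sasakian manifold of maximal rank `4n+3` is
necessarily 3-α-Sasakian, with `α = c/2`. -/
theorem maximalRank_threeAlphaSasakian (F V : Type) [CommRing F] [Algebra ℝ F] [AddCommGroup V] [Module F V]
    [SmoothSetting F V] [ACM3 F V] [ThreeQS F V]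
    [HasRank F V (dimn F V)] :
    Is3AlphaSasakianWith F V (cc F V / 2) := by
  refine ⟨div_ne_zero (HasRank.c_ne (l := dimn F V)) two_ne_zero,
    fun a => (isQuasiSasakian a).1, fun a X Y => ?_⟩
  obtain ⟨b, c, h⟩ := exists_cyclic a
  exact h.dOne_et_eq X Y

end QS3
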